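/- For every integer k ≥ 2 and every index m ∈ ℕ there exists a weak Jacobi form F_{2k,m} of weight 2k and index m with integral Fourier coefficients whose q⁰-term equals 1, i.e. whose Fourier coefficients f(n,l) satisfy f(0,0) = 1 and f(0,l) = 0 for all l ≠ 0. -/

import Mathlib

noncomputable section

open Complex

namespace JacobiPaper

/-- `e2 w = e^{2 π i w}`. -/
def e2 (w : ℂ) : ℂ := Complex.exp (2 * (Real.pi : ℂ) * Complex.I * w)

/-- `q = e^{2 π i τ}`. -/
def qC (τ : ℂ) : ℂ := e2 τ

/-- `ζ = e^{2 π i z}`. -/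
def zetaC (z : ℂ) : ℂ := e2 z

/-- The Dedekind eta function `η(τ) = q^{1/24} ∏_{n ≥ 1} (1 - qⁿ)`. -/
def eta (τ : ℂ) : ℂ :=
  Complex.exp ((Real.pi : ℂ) * Complex.I * τ / 12) * ∏' n : ℕ, (1 - qC τ ^ (n + 1))

/-- The odd Jacobi theta function
`ϑ(τ,z) = q^{1/8} (ζ^{1/2} - ζ^{-1/2}) ∏_{n ≥ 1} (1 - qⁿζ)(1 - qⁿζ⁻¹)(1 - qⁿ)`. -/
def theta (τ z : ℂ) : ℂ :=
  Complex.exp ((Real.pi : ℂ) * Complex.I * τ / 4) *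
    (Complex.exp ((Real.pi : ℂ) * Complex.I * z) - Complex.exp (-((Real.pi : ℂ) * Complex.I * z))) *
    ∏' n : ℕ,
      ((1 - qC τ ^ (n + 1) * zetaC z) * (1 - qC τ ^ (n + 1) * (zetaC z)⁻¹) * (1 - qC τ ^ (n + 1)))

/-- `ϑ₀₀(τ,z) = Σ_{n ∈ ℤ} q^{n²/2} ζⁿ`. -/
def theta00 (τ z : ℂ) : ℂ :=
  ∑' n : ℤ, Complex.exp ((Real.pi : ℂ) * Complex.I * (n : ℂ) ^ 2 * τ +
    2 * (Real.pi : ℂ) * Complex.I * (n : ℂ) * z)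

/-- `ϑ₀₁(τ,z) = Σ_{n ∈ ℤ} (-1)ⁿ q^{n²/2} ζⁿ`. -/
def theta01 (τ z : ℂ) : ℂ :=
  ∑' n : ℤ, (-1 : ℂ) ^ n * Complex.exp ((Real.pi : ℂ) * Complex.I * (n : ℂ) ^ 2 * τ +
    2 * (Real.pi : ℂ) * Complex.I * (n : ℂ) * z)

/-- `ϑ₁₀(τ,z) = q^{1/8} ζ^{1/2} Σ_{n ∈ ℤ} q^{n(n+1)/2} ζⁿ`. -/
def theta10 (τ z : ℂ) : ℂ :=
  Complex.exp ((Real.pi : ℂ) * Complex.I * τ / 4) * Complex.exp ((Real.pi : ℂ) * Complex.I * z) *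
    ∑' n : ℤ, Complex.exp ((Real.pi : ℂ) * Complex.I * (n : ℂ) * ((n : ℂ) + 1) * τ +
      2 * (Real.pi : ℂ) * Complex.I * (n : ℂ) * z)

/-- `ξ₀₀(τ,z) = ϑ₀₀(τ,z)/ϑ₀₀(τ,0)`. -/
def xi00 (τ z : ℂ) : ℂ := theta00 τ z / theta00 τ 0

/-- `ξ₀₁(τ,z) = ϑ₀₁(τ,z)/ϑ₀₁(τ,0)`. -/
def xi01 (τ z : ℂ) : ℂ := theta01 τ z / theta01 τ 0

/-- `ξ₁₀(τ,z) = ϑ₁₀(τ,z)/ϑ₁₀(τ,0)`. -/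
def xi10 (τ z : ℂ) : ℂ := theta10 τ z / theta10 τ 0

/-- The weak Jacobi form `φ_{0,1} = 4(ξ₀₀² + ξ₀₁² + ξ₁₀²)`. -/
def phi01 (τ z : ℂ) : ℂ := 4 * (xi00 τ z ^ 2 + xi01 τ z ^ 2 + xi10 τ z ^ 2)

/-- The weak Jacobi form `φ_{0,2}(τ,z) = 2(ξ₀₀ + ξ₀₁ + ξ₁₀)(τ,2z)`. -/
def phi02 (τ z : ℂ) : ℂ := 2 * (xi00 τ (2 * z) + xi01 τ (2 * z) + xi10 τ (2 * z))

/-- The weak Jacobi form `φ_{0,3}(τ,z) = ϑ(τ,2z)²/ϑ(τ,z)²`. -/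
def phi03 (τ z : ℂ) : ℂ := theta τ (2 * z) ^ 2 / theta τ z ^ 2

/-- The weak Jacobi form `φ_{0,4}(τ,z) = ϑ(τ,3z)/ϑ(τ,z)`. -/
def phi04 (τ z : ℂ) : ℂ := theta τ (3 * z) / theta τ z

/-- The weak Jacobi form `φ_{-2,1}(τ,z) = ϑ(τ,z)²/η(τ)⁶`. -/
def phiM21 (τ z : ℂ) : ℂ := theta τ z ^ 2 / eta τ ^ 6

/-- The divisor power sum `σ_k(n)`. -/
def sigma' (k n : ℕ) : ℕ := ∑ d ∈ n.divisors, d ^ k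

/-- The normalized Eisenstein series `E_k(τ) = 1 - (2k/B_k) Σ_{n ≥ 1} σ_{k-1}(n) qⁿ`. -/
def Eis (k : ℕ) (τ : ℂ) : ℂ :=
  1 - (2 * (k : ℂ) / ((bernoulli k : ℚ) : ℂ)) *
    ∑' n : ℕ, (sigma' (k - 1) (n + 1) : ℂ) * qC τ ^ (n + 1)

/-- The discriminant cusp form `Δ = η²⁴`. -/
def Delta (τ : ℂ) : ℂ := eta τ ^ 24

/-- The modular invariant `j = E₄³/Δ`. -/
def jInv (τ : ℂ) : ℂ := Eis 4 τ ^ 3 / Delta τ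

/-- A choice of `(a, b)` with `a d - b c = 1` completing a coprime pair `(c, d)` to a matrix
`(a b; c d) ∈ SL₂(ℤ)`. -/
def bezout (c d : ℤ) : ℤ × ℤ :=
  haveI : Decidable (∃ ab : ℤ × ℤ, ab.1 * d - ab.2 * c = 1) := Classical.propDecidable _
  if h : ∃ ab : ℤ × ℤ, ab.1 * d - ab.2 * c = 1 then h.choose else 0

/-- The summand `(cτ+d)^{-k} Σ_{l ∈ ℤ} e^{2πim(l²(aτ+b)/(cτ+d) + 2lz/(cτ+d) - cz²/(cτ+d))}`
of the Jacobi–Eisenstein series attached to a coprime pair `(c,d)`; it does not depend on the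
choice of `(a,b)` completing `(c,d)` to an element of `SL₂(ℤ)`. -/
def EisJSummand (k m : ℕ) (τ z : ℂ) (c d : ℤ) : ℂ :=
  ((c : ℂ) * τ + (d : ℂ)) ^ (-(k : ℤ)) *
    ∑' l : ℤ, e2 ((m : ℂ) * ((l : ℂ) ^ 2 * (((bezout c d).1 : ℂ) * τ + ((bezout c d).2 : ℂ)) /
        ((c : ℂ) * τ + (d : ℂ)) +
      2 * (l : ℂ) * z / ((c : ℂ) * τ + (d : ℂ)) - (c : ℂ) * z ^ 2 / ((c : ℂ) * τ + (d : ℂ))))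

/-- The Jacobi–Eisenstein series `E_{k,m}` of weight `k` and index `m`. -/
def EisJ (k m : ℕ) (τ z : ℂ) : ℂ :=
  (1 / 2) * ∑' p : {p : ℤ × ℤ // IsCoprime p.1 p.2}, EisJSummand k m τ z p.1.1 p.1.2

/-- `F_{6,3} = (1/2)(E_{6,1} φ_{0,2} - E₆ φ_{0,3})`. -/
def F63 (τ z : ℂ) : ℂ := (1 / 2) * (EisJ 6 1 τ z * phi02 τ z - Eis 6 τ * phi03 τ z)

/-- A weak Jacobi form of weight `k ∈ ℤ` and index `m ∈ ℕ`: a holomorphic function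
`φ : ℍ × ℂ → ℂ` satisfying the two Jacobi transformation laws and having a Fourier expansion
`φ(τ,z) = Σ_{n ≥ 0, l ∈ ℤ} f(n,l) qⁿ ζˡ`. -/
def IsWeakJacobiForm (k : ℤ) (m : ℕ) (φ : ℂ → ℂ → ℂ) (f : ℕ → ℤ → ℂ) : Prop :=
  DifferentiableOn ℂ (fun p : ℂ × ℂ => φ p.1 p.2) {p : ℂ × ℂ | 0 < p.1.im} ∧
  (∀ a b c d : ℤ, a * d - b * c = 1 → ∀ τ z : ℂ, 0 < τ.im →
    φ (((a : ℂ) * τ + (b : ℂ)) / ((c : ℂ) * τ + (d : ℂ))) (z / ((c : ℂ) * τ + (d : ℂ))) =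
      ((c : ℂ) * τ + (d : ℂ)) ^ k *
        e2 ((m : ℂ) * ((c : ℂ) * z ^ 2 / ((c : ℂ) * τ + (d : ℂ)))) * φ τ z) ∧
  (∀ x y : ℤ, ∀ τ z : ℂ, 0 < τ.im →
    φ τ (z + (x : ℂ) * τ + (y : ℂ)) =
      e2 (-(m : ℂ) * ((x : ℂ) ^ 2 * τ + 2 * (x : ℂ) * z)) * φ τ z) ∧
  (∀ τ z : ℂ, 0 < τ.im →
    HasSum (fun p : ℕ × ℤ => f p.1 p.2 * e2 ((p.1 : ℂ) * τ + (p.2 : ℂ) * z)) (φ τ z))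

/-- A weakly holomorphic Jacobi form of weight `0` and index `m ∈ ℕ`: as a weak Jacobi form,
but the Fourier expansion `φ(τ,z) = Σ_{n ≥ n₀, l ∈ ℤ} f(n,l) qⁿ ζˡ` may contain finitely many
negative powers of `q`. -/
def IsWeaklyHolomorphicJacobiForm0 (m : ℕ) (φ : ℂ → ℂ → ℂ) (f : ℤ → ℤ → ℂ) : Prop :=
  DifferentiableOn ℂ (fun p : ℂ × ℂ => φ p.1 p.2) {p : ℂ × ℂ | 0 < p.1.im} ∧
  (∀ a b c d : ℤ, a * d - b * c = 1 → ∀ τ z : ℂ, 0 < τ.im →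
    φ (((a : ℂ) * τ + (b : ℂ)) / ((c : ℂ) * τ + (d : ℂ))) (z / ((c : ℂ) * τ + (d : ℂ))) =
      e2 ((m : ℂ) * ((c : ℂ) * z ^ 2 / ((c : ℂ) * τ + (d : ℂ)))) * φ τ z) ∧
  (∀ x y : ℤ, ∀ τ z : ℂ, 0 < τ.im →
    φ τ (z + (x : ℂ) * τ + (y : ℂ)) =
      e2 (-(m : ℂ) * ((x : ℂ) ^ 2 * τ + 2 * (x : ℂ) * z)) * φ τ z) ∧
  (∃ n₀ : ℤ, ∀ n : ℤ, n < n₀ → ∀ l : ℤ, f n l = 0) ∧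
  (∀ τ z : ℂ, 0 < τ.im →
    HasSum (fun p : ℤ × ℤ => f p.1 p.2 * e2 ((p.1 : ℂ) * τ + (p.2 : ℂ) * z)) (φ τ z))

/-- A function `φ` on `ℍ × ℂ` has integral Fourier coefficients if it is the sum of a Fourier
series `Σ_{n ≥ 0, l ∈ ℤ} f(n,l) qⁿ ζˡ` with all `f(n,l) ∈ ℤ`. -/
def HasIntegralFourierExpansion (φ : ℂ → ℂ → ℂ) : Prop :=
  ∃ f : ℕ → ℤ → ℤ, ∀ τ z : ℂ, 0 < τ.im →
    HasSum (fun p : ℕ × ℤ => (f p.1 p.2 : ℂ) * e2 ((p.1 : ℂ) * τ + (p.2 : ℂ) * z)) (φ τ z)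

/-! ### Transformation laws of the theta functions -/

lemma theta00_eq (τ z : ℂ) : theta00 τ z = jacobiTheta₂ z τ := by
  refine tsum_congr fun n => ?_
  rw [jacobiTheta₂_term]
  congr 1
  ring

lemma exp_pi_mul_int (n : ℤ) : cexp (Real.pi * I * n) = (-1) ^ n := by
  rw [mul_comm, Complex.exp_int_mul, Complex.exp_pi_mul_I]

lemma theta01_eq (τ z : ℂ) : theta01 τ z = jacobiTheta₂ (z + 1 / 2) τ := by
  refine tsum_congr fun n => ?_
  rw [jacobiTheta₂_term, ← exp_pi_mul_int, ← Complex.exp_add]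
  congr 1
  ring

lemma theta10_eq (τ z : ℂ) :
    theta10 τ z = cexp (Real.pi * I * τ / 4 + Real.pi * I * z) * jacobiTheta₂ (z + τ / 2) τ := by
  rw [theta10, Complex.exp_add]
  congr 1
  refine tsum_congr fun n => ?_
  rw [jacobiTheta₂_term]
  congr 1
  ring

lemma jacobiTheta₂_add_one_right (z τ : ℂ) :
    jacobiTheta₂ z (τ + 1) = jacobiTheta₂ (z + 1 / 2) τ := by
  refine tsum_congr fun n => ?_
  have h : cexp (Real.pi * I * n ^ 2) = cexp (Real.pi * I * n) := by
    have h2 := exp_pi_mul_int (n ^ 2)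
    push_cast at h2
    rw [h2, exp_pi_mul_int]
    rcases Int.even_or_odd n with hn | hn
    · rw [hn.neg_one_zpow, (hn.pow_of_ne_zero two_ne_zero).neg_one_zpow]
    · rw [hn.neg_one_zpow, hn.pow.neg_one_zpow]
  rw [jacobiTheta₂_term, jacobiTheta₂_term,
    show 2 * (Real.pi : ℂ) * I * n * z + Real.pi * I * n ^ 2 * (τ + 1) =
      (2 * Real.pi * I * n * z + Real.pi * I * n ^ 2 * τ) + Real.pi * I * n ^ 2 by ring,
    Complex.exp_add, h, ← Complex.exp_add]
  congr 1
  ring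

lemma jacobiTheta₂_add_lattice (z τ : ℂ) (x y : ℤ) :
    jacobiTheta₂ (z + x * τ + y) τ =
      cexp (-(Real.pi * I * (x ^ 2 * τ + 2 * x * z))) * jacobiTheta₂ z τ := by
  conv_rhs => rw [jacobiTheta₂, ← tsum_mul_left, ← (Equiv.addRight x).tsum_eq]
  refine tsum_congr fun n => ?_
  simp_rw [jacobiTheta₂_term, ← Complex.exp_add, Equiv.coe_addRight, Int.cast_add]
  rw [Complex.exp_eq_exp_iff_exists_int]
  exact ⟨n * y, by push_cast; ring⟩

lemma theta00_add_lattice (τ z : ℂ) (x y : ℤ) :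
    theta00 τ (z + x * τ + y) =
      cexp (-(Real.pi * I * (x ^ 2 * τ + 2 * x * z))) * theta00 τ z := by
  rw [theta00_eq, theta00_eq, jacobiTheta₂_add_lattice]

lemma theta01_add_lattice (τ z : ℂ) (x y : ℤ) :
    theta01 τ (z + x * τ + y) =
      cexp (-(Real.pi * I * (x ^ 2 * τ + 2 * x * z)) - Real.pi * I * x) * theta01 τ z := by
  rw [theta01_eq, theta01_eq, show z + x * τ + y + 1 / 2 = (z + 1 / 2) + x * τ + y by ring,
    jacobiTheta₂_add_lattice]
  congr 2
  ring

lemma theta10_add_lattice (τ z : ℂ) (x y : ℤ) :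
    theta10 τ (z + x * τ + y) =
      cexp (-(Real.pi * I * (x ^ 2 * τ + 2 * x * z)) + Real.pi * I * y) * theta10 τ z := by
  rw [theta10_eq, theta10_eq, show z + x * τ + y + τ / 2 = (z + τ / 2) + x * τ + y by ring,
    jacobiTheta₂_add_lattice, ← mul_assoc, ← mul_assoc, ← Complex.exp_add, ← Complex.exp_add]
  congr 2
  ring

lemma theta00_add_one (τ z : ℂ) : theta00 (τ + 1) z = theta01 τ z := by
  rw [theta00_eq, theta01_eq, jacobiTheta₂_add_one_right]

lemma theta01_add_one (τ z : ℂ) : theta01 (τ + 1) z = theta00 τ z := by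
  rw [theta00_eq, theta01_eq, jacobiTheta₂_add_one_right,
    show z + 1 / 2 + 1 / 2 = z + 1 by ring, jacobiTheta₂_add_left]

lemma theta10_add_one (τ z : ℂ) :
    theta10 (τ + 1) z = cexp (Real.pi * I / 4) * theta10 τ z := by
  rw [theta10_eq, theta10_eq, jacobiTheta₂_add_one_right,
    show z + (τ + 1) / 2 + 1 / 2 = (z + τ / 2) + 1 by ring, jacobiTheta₂_add_left, ← mul_assoc,
    ← Complex.exp_add]
  congr 2
  ring

lemma jacobiTheta₂_inv {τ : ℂ} (hτ : τ ≠ 0) (z : ℂ) :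
    jacobiTheta₂ (z / τ) (-1 / τ) =
      (-I * τ) ^ (1 / 2 : ℂ) * cexp (Real.pi * I * z ^ 2 / τ) * jacobiTheta₂ z τ := by
  have h : (-I * τ) ^ (1 / 2 : ℂ) ≠ 0 := by
    rw [Complex.cpow_ne_zero_iff_of_exponent_ne_zero (by norm_num)]
    simp [hτ]
  rw [jacobiTheta₂_functional_equation z τ]
  have e : cexp (Real.pi * I * z ^ 2 / τ) * cexp (-Real.pi * I * z ^ 2 / τ) = 1 := by
    rw [← Complex.exp_add, ← Complex.exp_zero]
    congr 1
    ring
  linear_combination (-jacobiTheta₂ (z / τ) (-1 / τ)) * e -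
    cexp (Real.pi * I * z ^ 2 / τ) * cexp (-Real.pi * I * z ^ 2 / τ) *
      jacobiTheta₂ (z / τ) (-1 / τ) * mul_one_div_cancel h

lemma theta00_inv {τ : ℂ} (hτ : τ ≠ 0) (z : ℂ) :
    theta00 (-1 / τ) (z / τ) =
      (-I * τ) ^ (1 / 2 : ℂ) * cexp (Real.pi * I * z ^ 2 / τ) * theta00 τ z := by
  rw [theta00_eq, theta00_eq, jacobiTheta₂_inv hτ]

lemma theta01_inv {τ : ℂ} (hτ : τ ≠ 0) (z : ℂ) :
    theta01 (-1 / τ) (z / τ) =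
      (-I * τ) ^ (1 / 2 : ℂ) * cexp (Real.pi * I * z ^ 2 / τ) * theta10 τ z := by
  rw [theta01_eq, theta10_eq, show z / τ + 1 / 2 = (z + τ / 2) / τ by field_simp,
    jacobiTheta₂_inv hτ]
  have e : cexp (Real.pi * I * (z + τ / 2) ^ 2 / τ) =
      cexp (Real.pi * I * z ^ 2 / τ) * cexp (Real.pi * I * τ / 4 + Real.pi * I * z) := by
    rw [← Complex.exp_add]
    congr 1
    field_simp
    ring
  rw [e]
  ring

lemma theta10_inv {τ : ℂ} (hτ : τ ≠ 0) (z : ℂ) :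
    theta10 (-1 / τ) (z / τ) =
      (-I * τ) ^ (1 / 2 : ℂ) * cexp (Real.pi * I * z ^ 2 / τ) * theta01 τ z := by
  rw [theta01_eq, theta10_eq, show z / τ + -1 / τ / 2 = (z - 1 / 2) / τ by field_simp; ring,
    jacobiTheta₂_inv hτ, ← jacobiTheta₂_add_left (z - 1 / 2),
    show z - 1 / 2 + 1 = z + 1 / 2 by ring]
  have e : cexp (Real.pi * I * z ^ 2 / τ) =
      cexp (Real.pi * I * (-1 / τ) / 4 + Real.pi * I * (z / τ)) *
        cexp (Real.pi * I * (z - 1 / 2) ^ 2 / τ) := by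
    rw [← Complex.exp_add]
    congr 1
    field_simp
    ring
  rw [e]
  ring

/-! ### Products of four theta functions -/

/-- `∏ᵢ ϑ₀₀(τ, aᵢz)`. -/
def prod00 (a : Fin 4 → ℤ) (τ z : ℂ) : ℂ := ∏ i, theta00 τ (a i * z)

/-- `∏ᵢ ϑ₀₁(τ, aᵢz)`. -/
def prod01 (a : Fin 4 → ℤ) (τ z : ℂ) : ℂ := ∏ i, theta01 τ (a i * z)

/-- `∏ᵢ ϑ₁₀(τ, aᵢz)`. -/
def prod10 (a : Fin 4 → ℤ) (τ z : ℂ) : ℂ := ∏ i, theta10 τ (a i * z)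

lemma prod00_add_one (a : Fin 4 → ℤ) (τ z : ℂ) : prod00 a (τ + 1) z = prod01 a τ z := by
  simp only [prod00, prod01, theta00_add_one]

lemma prod01_add_one (a : Fin 4 → ℤ) (τ z : ℂ) : prod01 a (τ + 1) z = prod00 a τ z := by
  simp only [prod00, prod01, theta01_add_one]

lemma prod10_add_one (a : Fin 4 → ℤ) (τ z : ℂ) : prod10 a (τ + 1) z = -prod10 a τ z := by
  have h : cexp (Real.pi * I / 4) ^ 4 = -1 := by
    rw [← Complex.exp_nat_mul, ← Complex.exp_pi_mul_I]
    congr 1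
    push_cast
    ring
  simp only [prod10, theta10_add_one, Finset.prod_mul_distrib, Finset.prod_const,
    Finset.card_univ, Fintype.card_fin, h, neg_one_mul]

lemma cpow_half_pow_four (w : ℂ) : ((-I * w) ^ (1 / 2 : ℂ)) ^ 4 = -w ^ 2 := by
  rw [show (1 / 2 : ℂ) = ((2 : ℕ) : ℂ)⁻¹ by norm_num, show 4 = 2 * 2 by norm_num, pow_mul,
    Complex.cpow_nat_inv_pow _ two_ne_zero, mul_pow, neg_sq, I_sq, neg_one_mul]

lemma prod_inv_of_inv {f g : ℂ → ℂ → ℂ} {τ : ℂ}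
    (h : ∀ z, f (-1 / τ) (z / τ) =
      (-I * τ) ^ (1 / 2 : ℂ) * cexp (Real.pi * I * z ^ 2 / τ) * g τ z)
    {m : ℕ} {a : Fin 4 → ℤ} (ha : ∑ i, a i ^ 2 = 2 * m) (z : ℂ) :
    ∏ i, f (-1 / τ) (a i * (z / τ)) = -τ ^ 2 * e2 (m * z ^ 2 / τ) * ∏ i, g τ (a i * z) := by
  have ha' : ∑ i, (a i : ℂ) ^ 2 = 2 * m := by exact_mod_cast ha
  simp only [← mul_div_assoc, h, Finset.prod_mul_distrib, Finset.prod_const, Finset.card_univ,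
    Fintype.card_fin, cpow_half_pow_four, ← Complex.exp_sum, e2]
  congr 3
  simp only [mul_pow, ← Finset.sum_div, ← Finset.mul_sum, ← Finset.sum_mul, ha']
  ring

lemma prod00_inv {τ : ℂ} (hτ : τ ≠ 0) {m : ℕ} {a : Fin 4 → ℤ} (ha : ∑ i, a i ^ 2 = 2 * m)
    (z : ℂ) : prod00 a (-1 / τ) (z / τ) = -τ ^ 2 * e2 (m * z ^ 2 / τ) * prod00 a τ z :=
  prod_inv_of_inv (theta00_inv hτ) ha z

lemma prod01_inv {τ : ℂ} (hτ : τ ≠ 0) {m : ℕ} {a : Fin 4 → ℤ} (ha : ∑ i, a i ^ 2 = 2 * m)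
    (z : ℂ) : prod01 a (-1 / τ) (z / τ) = -τ ^ 2 * e2 (m * z ^ 2 / τ) * prod10 a τ z :=
  prod_inv_of_inv (theta01_inv hτ) ha z

lemma prod10_inv {τ : ℂ} (hτ : τ ≠ 0) {m : ℕ} {a : Fin 4 → ℤ} (ha : ∑ i, a i ^ 2 = 2 * m)
    (z : ℂ) : prod10 a (-1 / τ) (z / τ) = -τ ^ 2 * e2 (m * z ^ 2 / τ) * prod01 a τ z :=
  prod_inv_of_inv (theta10_inv hτ) ha z

lemma prod_add_lattice_of_add_lattice {f : ℂ → ℂ → ℂ} {u v : ℤ}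
    (h : ∀ (τ z : ℂ) (x y : ℤ), f τ (z + x * τ + y) =
      cexp (-(Real.pi * I * (x ^ 2 * τ + 2 * x * z)) + Real.pi * I * (u * x + v * y)) * f τ z)
    {m : ℕ} {a : Fin 4 → ℤ} (ha : ∑ i, a i ^ 2 = 2 * m) {s : ℤ} (hs : ∑ i, a i = 2 * s)
    (τ z : ℂ) (x y : ℤ) :
    ∏ i, f τ (a i * (z + x * τ + y)) =
      e2 (-(m : ℂ) * ((x : ℂ) ^ 2 * τ + 2 * (x : ℂ) * z)) * ∏ i, f τ (a i * z) := by
  have ha' : ∑ i, (a i : ℂ) ^ 2 = 2 * m := by exact_mod_cast ha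
  have hs' : ∑ i, (a i : ℂ) = 2 * s := by exact_mod_cast hs
  have h' (i : Fin 4) : f τ (a i * (z + x * τ + y)) =
      cexp (-(Real.pi * I * (a i ^ 2 * (x ^ 2 * τ + 2 * x * z))) +
        Real.pi * I * (a i * (u * x + v * y))) * f τ (a i * z) := by
    rw [show (a i : ℂ) * (z + x * τ + y) = a i * z + (a i * x : ℤ) * τ + (a i * y : ℤ) by
      push_cast; ring, h]
    congr 2
    push_cast
    ring
  simp only [h', Finset.prod_mul_distrib, ← Complex.exp_sum, e2]
  congr 1
  rw [Finset.sum_add_distrib, Finset.sum_neg_distrib, ← Finset.mul_sum, ← Finset.mul_sum,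
    ← Finset.sum_mul, ← Finset.sum_mul, ha', hs', Complex.exp_eq_exp_iff_exists_int]
  exact ⟨s * (u * x + v * y), by push_cast; ring⟩

lemma prod00_add_lattice {m : ℕ} {a : Fin 4 → ℤ} (ha : ∑ i, a i ^ 2 = 2 * m) {s : ℤ}
    (hs : ∑ i, a i = 2 * s) (τ z : ℂ) (x y : ℤ) : prod00 a τ (z + x * τ + y) =
      e2 (-(m : ℂ) * ((x : ℂ) ^ 2 * τ + 2 * (x : ℂ) * z)) * prod00 a τ z :=
  prod_add_lattice_of_add_lattice (u := 0) (v := 0)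
    (fun τ z x y => by rw [theta00_add_lattice]; congr 2; push_cast; ring) ha hs τ z x y

lemma prod01_add_lattice {m : ℕ} {a : Fin 4 → ℤ} (ha : ∑ i, a i ^ 2 = 2 * m) {s : ℤ}
    (hs : ∑ i, a i = 2 * s) (τ z : ℂ) (x y : ℤ) : prod01 a τ (z + x * τ + y) =
      e2 (-(m : ℂ) * ((x : ℂ) ^ 2 * τ + 2 * (x : ℂ) * z)) * prod01 a τ z :=
  prod_add_lattice_of_add_lattice (u := -1) (v := 0)
    (fun τ z x y => by rw [theta01_add_lattice]; congr 2; push_cast; ring) ha hs τ z x y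

lemma prod10_add_lattice {m : ℕ} {a : Fin 4 → ℤ} (ha : ∑ i, a i ^ 2 = 2 * m) {s : ℤ}
    (hs : ∑ i, a i = 2 * s) (τ z : ℂ) (x y : ℤ) : prod10 a τ (z + x * τ + y) =
      e2 (-(m : ℂ) * ((x : ℂ) ^ 2 * τ + 2 * (x : ℂ) * z)) * prod10 a τ z :=
  prod_add_lattice_of_add_lattice (u := 0) (v := 1)
    (fun τ z x y => by rw [theta10_add_lattice]; congr 2; push_cast; ring) ha hs τ z x y

lemma differentiableOn_jacobiTheta₂ {u : ℂ × ℂ → ℂ} (hu : Differentiable ℂ u) :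
    DifferentiableOn ℂ (fun p : ℂ × ℂ => jacobiTheta₂ (u p) p.1) {p : ℂ × ℂ | 0 < p.1.im} := by
  intro p hp
  refine DifferentiableAt.differentiableWithinAt ?_
  exact DifferentiableAt.comp (f := fun p : ℂ × ℂ => (u p, p.1)) p
    (hasFDerivAt_jacobiTheta₂ (u p) hp).differentiableAt
    ((hu p).prodMk differentiableAt_fst)

lemma differentiableOn_prod_four {f : Fin 4 → ℂ × ℂ → ℂ} {s : Set (ℂ × ℂ)}
    (hf : ∀ i, DifferentiableOn ℂ (f i) s) : DifferentiableOn ℂ (fun p => ∏ i, f i p) s := by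
  simp only [Fin.prod_univ_four]
  exact (((hf 0).mul (hf 1)).mul (hf 2)).mul (hf 3)

lemma differentiableOn_prod00 (a : Fin 4 → ℤ) :
    DifferentiableOn ℂ (fun p : ℂ × ℂ => prod00 a p.1 p.2) {p : ℂ × ℂ | 0 < p.1.im} := by
  simp only [prod00, theta00_eq]
  exact differentiableOn_prod_four fun i =>
    differentiableOn_jacobiTheta₂ (u := fun p => a i * p.2) (by fun_prop)

lemma differentiableOn_prod01 (a : Fin 4 → ℤ) :
    DifferentiableOn ℂ (fun p : ℂ × ℂ => prod01 a p.1 p.2) {p : ℂ × ℂ | 0 < p.1.im} := by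
  simp only [prod01, theta01_eq]
  exact differentiableOn_prod_four fun i =>
    differentiableOn_jacobiTheta₂ (u := fun p => a i * p.2 + 1 / 2) (by fun_prop)

lemma differentiableOn_prod10 (a : Fin 4 → ℤ) :
    DifferentiableOn ℂ (fun p : ℂ × ℂ => prod10 a p.1 p.2) {p : ℂ × ℂ | 0 < p.1.im} := by
  simp only [prod10, theta10_eq]
  exact differentiableOn_prod_four fun i =>
    DifferentiableOn.mul
      (Differentiable.differentiableOn
        (f := fun p : ℂ × ℂ => cexp (Real.pi * I * p.1 / 4 + Real.pi * I * (a i * p.2)))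
        (by fun_prop))
      (differentiableOn_jacobiTheta₂ (u := fun p => a i * p.2 + p.1 / 2) (by fun_prop))

/-! ### The modular transformation law -/

lemma denom_ne_zero {a b c d : ℤ} (h : a * d - b * c = 1) {τ : ℂ} (hτ : 0 < τ.im) :
    (c : ℂ) * τ + d ≠ 0 := by
  intro h0
  have him : (c : ℝ) * τ.im = 0 := by simpa using congrArg Complex.im h0
  have hc : c = 0 := by simpa [hτ.ne'] using him
  have hd : d = 0 := by simpa [hc] using h0
  simp [hc, hd] at h

lemma im_moebius_pos {a b c d : ℤ} (h : a * d - b * c = 1) {τ : ℂ} (hτ : 0 < τ.im) :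
    0 < (((a : ℂ) * τ + b) / ((c : ℂ) * τ + d)).im := by
  have h' : (a : ℝ) * d - b * c = 1 := by exact_mod_cast h
  have hn := Complex.normSq_pos.mpr (denom_ne_zero h hτ)
  rw [Complex.div_im, ← sub_div]
  refine div_pos ?_ hn
  simp only [add_im, mul_im, intCast_re, intCast_im, add_re, mul_re]
  linear_combination hτ - τ.im * h'

/-- Invariance of `φ` under the slash action of weight `k` and index `m` of `(a b; c d)`. -/
def SlashInvariant (k : ℤ) (m : ℕ) (φ : ℂ → ℂ → ℂ) (a b c d : ℤ) : Prop :=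
  ∀ τ z : ℂ, 0 < τ.im →
    φ (((a : ℂ) * τ + (b : ℂ)) / ((c : ℂ) * τ + (d : ℂ))) (z / ((c : ℂ) * τ + (d : ℂ))) =
      ((c : ℂ) * τ + (d : ℂ)) ^ k *
        e2 ((m : ℂ) * ((c : ℂ) * z ^ 2 / ((c : ℂ) * τ + (d : ℂ)))) * φ τ z

lemma e2_add (u v : ℂ) : e2 (u + v) = e2 u * e2 v := by
  rw [e2, mul_add, Complex.exp_add, e2, e2]

lemma e2_zero : e2 0 = 1 := by simp [e2]

lemma e2_ne_zero (u : ℂ) : e2 u ≠ 0 := Complex.exp_ne_zero _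

lemma SlashInvariant.mul {k : ℤ} {m : ℕ} {φ : ℂ → ℂ → ℂ} {a b c d a' b' c' d' : ℤ}
    (h : SlashInvariant k m φ a b c d) (h' : SlashInvariant k m φ a' b' c' d')
    (hdet : a * d - b * c = 1) (hdet' : a' * d' - b' * c' = 1) :
    SlashInvariant k m φ (a * a' + b * c') (a * b' + b * d') (c * a' + d * c')
      (c * b' + d * d') := by
  intro τ z hτ
  have hD' := denom_ne_zero hdet' hτ
  have hτ' := im_moebius_pos hdet' hτ
  have hD := denom_ne_zero hdet hτ'
  have key := h _ (z / ((c' : ℂ) * τ + d')) hτ'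
  rw [h' τ z hτ] at key
  set D' : ℂ := (c' : ℂ) * τ + d' with hD'def
  set D : ℂ := (c : ℂ) * (((a' : ℂ) * τ + b') / D') + d with hDdef
  have hden : ((c * a' + d * c' : ℤ) : ℂ) * τ + ((c * b' + d * d' : ℤ) : ℂ) = D * D' := by
    rw [hDdef, add_mul, mul_assoc, div_mul_cancel₀ _ hD', hD'def]
    push_cast
    ring
  have hnum : ((a * a' + b * c' : ℤ) : ℂ) * τ + ((a * b' + b * d' : ℤ) : ℂ) =
      ((a : ℂ) * (((a' : ℂ) * τ + b') / D') + b) * D' := by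
    rw [add_mul, mul_assoc, div_mul_cancel₀ _ hD', hD'def]
    push_cast
    ring
  rw [hden, hnum, mul_div_mul_right _ _ hD', mul_comm D, ← div_div, key, mul_zpow,
    mul_comm D' D]
  have hdetC : (a' : ℂ) * d' - b' * c' = 1 := by exact_mod_cast hdet'
  have hc : ((c * a' + d * c' : ℤ) : ℂ) * D' = c + c' * (D * D') := by
    rw [← hden, hD'def]
    push_cast
    linear_combination (c : ℂ) * hdetC
  have he : (m : ℂ) * (((c * a' + d * c' : ℤ) : ℂ) * z ^ 2 / (D * D')) =
      m * (c * (z / D') ^ 2 / D) + m * (c' * z ^ 2 / D') := by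
    field_simp
    linear_combination (m : ℂ) * z ^ 2 * hc
  rw [he, e2_add]
  ring

lemma SlashInvariant.inv {k : ℤ} {m : ℕ} {φ : ℂ → ℂ → ℂ} {a b c d : ℤ}
    (h : SlashInvariant k m φ a b c d) (hdet : a * d - b * c = 1) :
    SlashInvariant k m φ d (-b) (-c) a := by
  intro τ z hτ
  have hdet' : d * a - (-b) * (-c) = 1 := by linear_combination hdet
  have hdetC : (a : ℂ) * d - b * c = 1 := by exact_mod_cast hdet
  have hD' := denom_ne_zero hdet' hτ
  have hτ' := im_moebius_pos hdet' hτ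
  have key := h _ (z / (((-c : ℤ) : ℂ) * τ + a)) hτ'
  set D' : ℂ := ((-c : ℤ) : ℂ) * τ + a with hD'def
  have hden : (c : ℂ) * (((d : ℂ) * τ + (-b : ℤ)) / D') + d = D'⁻¹ := by
    field_simp
    rw [hD'def]
    push_cast
    linear_combination hdetC
  have hnum : (a : ℂ) * (((d : ℂ) * τ + (-b : ℤ)) / D') + b = τ * D'⁻¹ := by
    field_simp
    rw [hD'def]
    push_cast
    linear_combination τ * hdetC
  rw [hden, hnum, mul_div_cancel_right₀ _ (inv_ne_zero hD'), div_div,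
    mul_inv_cancel₀ hD', div_one] at key
  rw [key, inv_zpow]
  have he : e2 (m * (((-c : ℤ) : ℂ) * z ^ 2 / D')) * e2 (m * (c * (z / D') ^ 2 / D'⁻¹)) = 1 := by
    rw [← e2_add, ← e2_zero]
    congr 1
    push_cast
    field_simp
    ring
  have hk := mul_inv_cancel₀ (zpow_ne_zero k hD')
  linear_combination (-φ ((d * τ + (-b : ℤ)) / D') (z / D')) *
    (D' ^ k * (D' ^ k)⁻¹ * he + hk)

open Matrix.SpecialLinearGroup ModularGroup in
lemma slashInvariant_of_generators {k : ℤ} {m : ℕ} {φ : ℂ → ℂ → ℂ}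
    (hT : ∀ τ z : ℂ, 0 < τ.im → φ (τ + 1) z = φ τ z)
    (hS : ∀ τ z : ℂ, 0 < τ.im → φ (-1 / τ) (z / τ) = τ ^ k * e2 (m * z ^ 2 / τ) * φ τ z)
    {a b c d : ℤ} (hdet : a * d - b * c = 1) : SlashInvariant k m φ a b c d := by
  have main (γ : Matrix.SpecialLinearGroup (Fin 2) ℤ) :
      SlashInvariant k m φ (γ 0 0) (γ 0 1) (γ 1 0) (γ 1 1) := by
    have det_eq (γ : Matrix.SpecialLinearGroup (Fin 2) ℤ) :
        γ 0 0 * γ 1 1 - γ 0 1 * γ 1 0 = 1 := by rw [← Matrix.det_fin_two, γ.det_coe]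
    have hγ : γ ∈ Subgroup.closure {S, T} := by simp [SpecialLinearGroup.SL2Z_generators]
    induction hγ using Subgroup.closure_induction with
    | mem γ hγ =>
      rcases hγ with rfl | rfl
      · intro τ z hτ
        simpa [S, mul_div_assoc] using hS τ z hτ
      · intro τ z hτ
        simpa [T, e2_zero] using hT τ z hτ
    | one =>
      intro τ z _
      simp [e2_zero]
    | mul γ γ' _ _ h h' =>
      simpa [Matrix.mul_apply, Fin.sum_univ_two] using h.mul h' (det_eq γ) (det_eq γ')
    | inv γ _ h =>
      simpa [Matrix.SpecialLinearGroup.SL2_inv_expl] using h.inv (det_eq γ)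
  simpa using main ⟨!![a, b; c, d], by rw [Matrix.det_fin_two_of, hdet]⟩

/-! ### Integral Fourier expansions -/

/-- `f` has a Fourier expansion with integral coefficients in which only the exponents of `q`
that are at least `k` occur. Repetitions of exponents are allowed. -/
def HasExpansion (k : ℕ) (f : ℂ → ℂ → ℂ) : Prop :=
  ∃ (ι : Type) (c : ι → ℤ) (N : ι → ℕ) (L : ι → ℤ), (∀ x, c x ≠ 0 → k ≤ N x) ∧
    ∀ τ z : ℂ, 0 < τ.im → HasSum (fun x => (c x : ℂ) * e2 (N x * τ + L x * z)) (f τ z)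

namespace HasExpansion

variable {k l : ℕ} {f g : ℂ → ℂ → ℂ}

lemma mono (hf : HasExpansion k f) (h : l ≤ k) : HasExpansion l f := by
  obtain ⟨ι, c, N, L, hN, hs⟩ := hf
  exact ⟨ι, c, N, L, fun x hx => h.trans (hN x hx), hs⟩

lemma zero : HasExpansion k 0 :=
  ⟨Empty, Empty.elim, Empty.elim, Empty.elim, fun x => x.elim, fun _ _ _ => hasSum_empty⟩

lemma add (hf : HasExpansion k f) (hg : HasExpansion k g) : HasExpansion k (f + g) := by
  obtain ⟨ι, c, N, L, hN, hs⟩ := hf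
  obtain ⟨ι', c', N', L', hN', hs'⟩ := hg
  refine ⟨ι ⊕ ι', Sum.elim c c', Sum.elim N N', Sum.elim L L', ?_, fun τ z hτ => ?_⟩
  · rintro (x | x)
    · exact hN x
    · exact hN' x
  · exact HasSum.sum (hs τ z hτ) (hs' τ z hτ)

lemma neg (hf : HasExpansion k f) : HasExpansion k (-f) := by
  obtain ⟨ι, c, N, L, hN, hs⟩ := hf
  refine ⟨ι, -c, N, L, fun x hx => hN x (by simpa using hx), fun τ z hτ => ?_⟩
  simpa using (hs τ z hτ).neg

lemma mul (hf : HasExpansion k f) (hg : HasExpansion l g) : HasExpansion (k + l) (f * g) := by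
  obtain ⟨ι, c, N, L, hN, hs⟩ := hf
  obtain ⟨ι', c', N', L', hN', hs'⟩ := hg
  refine ⟨ι × ι', fun x => c x.1 * c' x.2, fun x => N x.1 + N' x.2, fun x => L x.1 + L' x.2,
    fun x hx => add_le_add (hN _ (left_ne_zero_of_mul hx)) (hN' _ (right_ne_zero_of_mul hx)),
    fun τ z hτ => ?_⟩
  have h := (hs τ z hτ).summable.norm
  have h' := (hs' τ z hτ).summable.norm
  have hm := (summable_mul_of_summable_norm h h').hasSum
  rw [← tsum_mul_tsum_of_summable_norm h h', (hs τ z hτ).tsum_eq, (hs' τ z hτ).tsum_eq] at hm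
  refine hm.congr_fun fun x => ?_
  push_cast
  rw [show ((N x.1 : ℂ) + N' x.2) * τ + (L x.1 + L' x.2) * z =
    (N x.1 * τ + L x.1 * z) + (N' x.2 * τ + L' x.2 * z) by ring, e2_add]
  ring

lemma mul_sub_one (hf : HasExpansion 1 (f - 1)) (hg : HasExpansion 1 (g - 1)) :
    HasExpansion 1 (f * g - 1) := by
  rw [show f * g - 1 = (f - 1) * (g - 1) + (f - 1) + (g - 1) by ring]
  exact (((hf.mul hg).mono one_le_two).add hf).add hg

lemma pow_sub_one (hf : HasExpansion 1 (f - 1)) (n : ℕ) : HasExpansion 1 (f ^ n - 1) := by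
  induction n with
  | zero => simpa using zero
  | succ n ih => exact pow_succ f n ▸ ih.mul_sub_one hf

lemma mul_of_sub_one (hf : HasExpansion 1 (f - 1)) (hg : HasExpansion 1 g) :
    HasExpansion 1 (f * g) := by
  rw [show f * g = (f - 1) * g + g by ring]
  exact ((hf.mul hg).mono one_le_two).add hg

lemma pow (hf : HasExpansion 1 f) {n : ℕ} (hn : 1 ≤ n) : HasExpansion 1 (f ^ n) := by
  induction n, hn using Nat.le_induction with
  | base => rwa [pow_one]
  | succ n _ ih => exact pow_succ f n ▸ (ih.mul hf).mono one_le_two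

lemma neg_one_pow_mul (hf : HasExpansion k f) (n : ℕ) : HasExpansion k ((-1) ^ n * f) := by
  rcases neg_one_pow_eq_or (ℂ → ℂ → ℂ) n with h | h
  · rwa [h, one_mul]
  · rw [h, neg_one_mul]
    exact hf.neg

end HasExpansion

/-! ### Expansions of the theta products in `q^{1/2}` -/

lemma natAbs_sq_cast (n : ℤ) : ((n.natAbs ^ 2 : ℕ) : ℂ) = (n : ℂ) ^ 2 := by
  rw [Nat.cast_pow, Nat.cast_natAbs, ← Int.cast_pow, sq_abs, Int.cast_pow]

lemma two_mul_im_pos {τ : ℂ} (hτ : 0 < τ.im) : 0 < (2 * τ).im := by simpa using hτ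

lemma hasSum_theta00 (a : ℤ) {τ : ℂ} (hτ : 0 < τ.im) (z : ℂ) :
    HasSum (fun n : ℤ => e2 (((n.natAbs ^ 2 : ℕ) : ℂ) * τ + ((a * n : ℤ) : ℂ) * z))
      (theta00 (2 * τ) (a * z)) := by
  rw [theta00_eq]
  refine (hasSum_jacobiTheta₂_term _ (two_mul_im_pos hτ)).congr_fun fun n => ?_
  rw [jacobiTheta₂_term, e2, natAbs_sq_cast]
  push_cast
  ring_nf

lemma hasSum_theta01 (a : ℤ) {τ : ℂ} (hτ : 0 < τ.im) (z : ℂ) :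
    HasSum (fun n : ℤ => ((Int.negOnePow n : ℤ) : ℂ) *
      e2 (((n.natAbs ^ 2 : ℕ) : ℂ) * τ + ((a * n : ℤ) : ℂ) * z)) (theta01 (2 * τ) (a * z)) := by
  rw [theta01_eq]
  refine (hasSum_jacobiTheta₂_term _ (two_mul_im_pos hτ)).congr_fun fun n => ?_
  rw [jacobiTheta₂_term, e2, natAbs_sq_cast, Int.cast_negOnePow, ← exp_pi_mul_int,
    ← Complex.exp_add]
  push_cast
  ring_nf

lemma hasExpansion_sub_one {f : ℂ → ℂ → ℂ} {c L : ℤ → ℤ} (hc : c 0 = 1) (hL : L 0 = 0)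
    (hf : ∀ τ z : ℂ, 0 < τ.im →
      HasSum (fun n : ℤ => (c n : ℂ) * e2 (((n.natAbs ^ 2 : ℕ) : ℂ) * τ + (L n : ℂ) * z)) (f τ z)) :
    HasExpansion 1 (f - 1) := by
  refine ⟨ℤ, fun n => if n = 0 then 0 else c n, fun n => n.natAbs ^ 2, L, fun n hn => ?_,
    fun τ z hτ => ?_⟩
  · refine Nat.one_le_iff_ne_zero.mpr (pow_ne_zero _ (Int.natAbs_ne_zero.mpr fun h => ?_))
    simp [h] at hn
  · have h := hasSum_ite_sub_hasSum (hf τ z hτ) 0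
    simp only [hc, hL, Int.natAbs_zero, ne_eq, two_ne_zero, not_false_eq_true, zero_pow,
      Nat.cast_zero, Int.cast_zero, zero_mul, add_zero, e2_zero, Int.cast_one, mul_one] at h
    refine h.congr_fun fun n => ?_
    by_cases hn : n = 0 <;> simp [hn]

lemma hasExpansion_prod00 (a : Fin 4 → ℤ) :
    HasExpansion 1 ((fun τ z => prod00 a (2 * τ) z) - 1) := by
  have h (i : Fin 4) : HasExpansion 1 ((fun τ z => theta00 (2 * τ) (a i * z)) - 1) :=
    hasExpansion_sub_one (c := fun _ => 1) (L := fun n => a i * n) rfl (mul_zero _)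
      fun τ z hτ => by simpa using hasSum_theta00 (a i) hτ z
  convert (((h 0).mul_sub_one (h 1)).mul_sub_one (h 2)).mul_sub_one (h 3) using 2
  ext τ z
  simp [prod00, Fin.prod_univ_four]

lemma hasExpansion_prod01 (a : Fin 4 → ℤ) :
    HasExpansion 1 ((fun τ z => prod01 a (2 * τ) z) - 1) := by
  have h (i : Fin 4) : HasExpansion 1 ((fun τ z => theta01 (2 * τ) (a i * z)) - 1) :=
    hasExpansion_sub_one (c := fun n => Int.negOnePow n) (L := fun n => a i * n) (by simp)
      (mul_zero _) fun τ z hτ => hasSum_theta01 (a i) hτ z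
  convert (((h 0).mul_sub_one (h 1)).mul_sub_one (h 2)).mul_sub_one (h 3) using 2
  ext τ z
  simp [prod01, Fin.prod_univ_four]

lemma hasExpansion_prod10 {a : Fin 4 → ℤ} {s : ℤ} (hs : ∑ i, a i = 2 * s) :
    HasExpansion 1 (fun τ z => prod10 a (2 * τ) z) := by
  have h (i : Fin 4) :
      HasExpansion 0 (fun τ z => jacobiTheta₂ (a i * z + τ) (2 * τ)) := by
    refine ⟨ℤ, fun _ => 1, fun n => (n ^ 2 + n).toNat, fun n => a i * n,
      fun _ _ => Nat.zero_le _, fun τ z hτ => ?_⟩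
    refine (hasSum_jacobiTheta₂_term _ (two_mul_im_pos hτ)).congr_fun fun n => ?_
    have hn : (((n ^ 2 + n).toNat : ℕ) : ℂ) = (n : ℂ) ^ 2 + n := by
      have h0 : 0 ≤ n ^ 2 + n := by
        rcases le_or_gt 0 n with h | h <;> nlinarith
      exact_mod_cast congrArg (Int.cast : ℤ → ℂ) (Int.toNat_of_nonneg h0)
    rw [jacobiTheta₂_term, e2, hn, Int.cast_one, one_mul]
    push_cast
    ring_nf
  have h0 : HasExpansion 1 (fun τ z => e2 (τ + s * z)) :=
    ⟨Unit, fun _ => 1, fun _ => 1, fun _ => s, fun _ _ => le_rfl,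
      fun τ z _ => by simp⟩
  convert h0.mul ((((h 0).mul (h 1)).mul (h 2)).mul (h 3)) using 1
  have hs' : ∑ i, (a i : ℂ) = 2 * s := by exact_mod_cast hs
  ext τ z
  simp only [prod10, theta10_eq, Finset.prod_mul_distrib, ← Complex.exp_sum, e2, Pi.mul_apply]
  congr 1
  · congr 1
    rw [Finset.sum_add_distrib, ← Finset.mul_sum, ← Finset.sum_mul, hs']
    simp
    ring
  · rw [Fin.prod_univ_four, mul_div_cancel_left₀ _ two_ne_zero]

/-- Collecting the terms with equal exponents in an integral expansion. -/
lemma exists_coeff_of_hasSum {ι : Type} {c : ι → ℤ} {e : ι → ℕ × ℤ} {f : ℂ → ℂ → ℂ}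
    (hf : ∀ τ z : ℂ, 0 < τ.im →
      HasSum (fun x => (c x : ℂ) * e2 ((e x).1 * τ + (e x).2 * z)) (f τ z))
    (h0 : ∀ x, c x ≠ 0 → (e x).1 ≠ 0) :
    ∃ b : ℕ → ℤ → ℤ, (∀ l, b 0 l = 0) ∧ ∀ τ z : ℂ, 0 < τ.im →
      HasSum (fun p : ℕ × ℤ => (b p.1 p.2 : ℂ) * e2 (p.1 * τ + p.2 * z)) (f τ z) := by
  refine ⟨fun n l => ∑ᶠ x : {x // e x = (n, l)}, c x, fun l => ?_, fun τ z hτ => ?_⟩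
  · refine finsum_eq_zero_of_forall_eq_zero fun x => ?_
    by_contra hx
    exact h0 _ hx (by rw [x.2])
  · refine HasSum.sigma ((Equiv.sigmaFiberEquiv e).hasSum_iff.mpr (hf τ z hτ)) fun p => ?_
    have hp := ((hf τ z hτ).summable.comp_injective
      (Subtype.val_injective (p := fun x => e x = p))).congr
      (g := fun x : {x // e x = p} => (c x : ℂ) * e2 (p.1 * τ + p.2 * z))
      fun x => by simp only [Function.comp_apply, x.2]
    rw [summable_mul_right_iff (e2_ne_zero _)] at hp
    have hfin : (Function.support fun x : {x // e x = p} => c x).Finite := by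
      have h1 := hp.tendsto_cofinite_zero.norm.eventually (gt_mem_nhds (by simp : ‖(0 : ℂ)‖ < 1))
      refine h1.subset fun x hx hlt => hx ?_
      change ‖(c x : ℂ)‖ < 1 at hlt
      rw [Complex.norm_intCast] at hlt
      exact Int.abs_lt_one_iff.mp (by exact_mod_cast hlt)
    have hsum : HasSum (fun x : {x // e x = p} => (c x : ℂ))
        ((∑ᶠ x : {x // e x = p}, c x : ℤ) : ℂ) := by
      rw [finsum_eq_sum _ hfin, Int.cast_sum]
      refine hasSum_sum_of_ne_finset_zero fun x hx => ?_
      simpa using hx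
    refine (hsum.mul_right (e2 (p.1 * τ + p.2 * z))).congr_fun fun x => ?_
    change (c x : ℂ) * e2 ((e x).1 * τ + (e x).2 * z) = _
    rw [x.2]

/-- The average of `f(τ,z)` and `f(τ+1,z)` keeps the integral powers of `q` in an
expansion in powers of `q^{1/2}`. -/
lemma exists_coeff_of_hasExpansion {f : ℂ → ℂ → ℂ}
    (hf : HasExpansion 1 (fun τ z => f (2 * τ) z)) :
    ∃ b : ℕ → ℤ → ℤ, (∀ l, b 0 l = 0) ∧ ∀ τ z : ℂ, 0 < τ.im →
      HasSum (fun p : ℕ × ℤ => (b p.1 p.2 : ℂ) * e2 (p.1 * τ + p.2 * z))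
        ((f τ z + f (τ + 1) z) / 2) := by
  obtain ⟨ι, c, N, L, hN, hs⟩ := hf
  refine exists_coeff_of_hasSum (c := fun x => if Even (N x) then c x else 0)
    (e := fun x => (N x / 2, L x)) (fun τ z hτ => ?_) fun x hx => ?_
  · have h1 := hs (τ / 2) z (by simpa using hτ)
    have h2 := hs ((τ + 1) / 2) z (by simpa using hτ)
    simp only [mul_div_cancel₀ _ (two_ne_zero (α := ℂ))] at h1 h2
    refine ((h1.add h2).div_const 2).congr_fun fun x => ?_
    have he : e2 (N x * ((τ + 1) / 2) + L x * z) =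
        (-1) ^ N x * e2 (N x * (τ / 2) + L x * z) := by
      rw [← Complex.exp_pi_mul_I, ← Complex.exp_nat_mul, e2, e2, ← Complex.exp_add]
      ring_nf
    rw [he]
    split_ifs with hx
    · obtain ⟨n, hn⟩ := hx
      rw [hn, Even.neg_one_pow ⟨n, rfl⟩, show (n + n) / 2 = n by omega]
      push_cast
      ring_nf
    · rw [(Nat.not_even_iff_odd.mp hx).neg_one_pow]
      simp
  · rcases em (Even (N x)) with h | h
    · have := hN x (by simpa [h] using hx)
      obtain ⟨n, hn⟩ := h
      change N x / 2 ≠ 0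
      omega
    · simp [h] at hx

/-! ### The Jacobi forms -/

/-- The theta constant `ϑ₀₀(τ,0)⁴`. -/
def const00 (τ : ℂ) : ℂ := prod00 0 τ 0

/-- The theta constant `ϑ₀₁(τ,0)⁴`. -/
def const01 (τ : ℂ) : ℂ := prod01 0 τ 0

/-- The theta constant `ϑ₁₀(τ,0)⁴`. -/
def const10 (τ : ℂ) : ℂ := prod10 0 τ 0

/-- The average of this function over `τ` and `τ + 1` is a weak Jacobi form of weight
`2j + 2`. -/
def thetaSeed (j : ℕ) (a : Fin 4 → ℤ) (τ z : ℂ) : ℂ :=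
  prod00 a τ z * const01 τ ^ j - prod00 a τ z * (-const10 τ) ^ j +
    (-1) ^ j * (prod10 a τ z * const01 τ ^ j)

/-- A weak Jacobi form of weight `2j + 2` and index `½ ∑ᵢ aᵢ²`. -/
def thetaForm (j : ℕ) (a : Fin 4 → ℤ) (τ z : ℂ) : ℂ :=
  (prod00 a τ z * (const01 τ ^ j - (-const10 τ) ^ j) +
    prod01 a τ z * (const00 τ ^ j - const10 τ ^ j) +
    (-1) ^ j * prod10 a τ z * (const01 τ ^ j - const00 τ ^ j)) / 2

lemma thetaForm_eq (j : ℕ) (a : Fin 4 → ℤ) (τ z : ℂ) :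
    thetaForm j a τ z = (thetaSeed j a τ z + thetaSeed j a (τ + 1) z) / 2 := by
  simp only [thetaForm, thetaSeed, const00, const01, const10, prod00_add_one, prod01_add_one,
    prod10_add_one, neg_neg]
  ring

lemma thetaForm_add_one (j : ℕ) (a : Fin 4 → ℤ) (τ z : ℂ) :
    thetaForm j a (τ + 1) z = thetaForm j a τ z := by
  simp only [thetaForm, const00, const01, const10, prod00_add_one, prod01_add_one,
    prod10_add_one, neg_neg]
  ring

lemma thetaForm_inv (j : ℕ) {a : Fin 4 → ℤ} {m : ℕ} (ha : ∑ i, a i ^ 2 = 2 * m) {τ : ℂ}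
    (hτ : τ ≠ 0) (z : ℂ) :
    thetaForm j a (-1 / τ) (z / τ) =
      τ ^ (2 * j + 2) * e2 (m * z ^ 2 / τ) * thetaForm j a τ z := by
  have h0 : ∑ i, (0 : Fin 4 → ℤ) i ^ 2 = 2 * (0 : ℕ) := by simp
  have e00 : const00 (-1 / τ) = -τ ^ 2 * const00 τ := by
    simpa [e2_zero, const00, const01, const10] using prod00_inv hτ h0 0
  have e01 : const01 (-1 / τ) = -τ ^ 2 * const10 τ := by
    simpa [e2_zero, const00, const01, const10] using prod01_inv hτ h0 0
  have e10 : const10 (-1 / τ) = -τ ^ 2 * const01 τ := by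
    simpa [e2_zero, const00, const01, const10] using prod10_inv hτ h0 0
  have hε : ((-1 : ℂ) ^ j) * (-1) ^ j = 1 := by rw [← mul_pow]; simp
  have hn (w : ℂ) : (-τ ^ 2 * w) ^ j = (-1) ^ j * τ ^ (2 * j) * w ^ j := by
    rw [pow_mul, ← mul_pow, ← mul_pow, neg_one_mul]
  have hn' (w : ℂ) : (-(-τ ^ 2 * w)) ^ j = τ ^ (2 * j) * w ^ j := by
    rw [pow_mul, ← mul_pow, neg_mul, neg_neg]
  rw [thetaForm, thetaForm, prod00_inv hτ ha, prod01_inv hτ ha, prod10_inv hτ ha, e00, e01, e10,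
    hn, hn, hn, hn', neg_pow (const10 τ), pow_add]
  linear_combination (-τ ^ 2 * e2 (m * z ^ 2 / τ) * prod01 a τ z * τ ^ (2 * j) *
    (const10 τ ^ j - const00 τ ^ j) / 2) * hε

lemma thetaForm_add_lattice (j : ℕ) {a : Fin 4 → ℤ} {m : ℕ} (ha : ∑ i, a i ^ 2 = 2 * m) {s : ℤ}
    (hs : ∑ i, a i = 2 * s) (τ z : ℂ) (x y : ℤ) : thetaForm j a τ (z + x * τ + y) =
      e2 (-(m : ℂ) * ((x : ℂ) ^ 2 * τ + 2 * (x : ℂ) * z)) * thetaForm j a τ z := by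
  simp only [thetaForm, prod00_add_lattice ha hs, prod01_add_lattice ha hs,
    prod10_add_lattice ha hs]
  ring

lemma differentiableOn_const {f : (Fin 4 → ℤ) → ℂ → ℂ → ℂ}
    (hf : DifferentiableOn ℂ (fun p : ℂ × ℂ => f 0 p.1 p.2) {p : ℂ × ℂ | 0 < p.1.im}) :
    DifferentiableOn ℂ (fun p : ℂ × ℂ => f 0 p.1 0) {p : ℂ × ℂ | 0 < p.1.im} := by
  have hu : Differentiable ℂ fun p : ℂ × ℂ => (p.1, (0 : ℂ)) := by fun_prop
  exact hf.comp (f := fun p : ℂ × ℂ => (p.1, (0 : ℂ))) hu.differentiableOn fun p hp => hp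

lemma differentiableOn_combination (j : ℕ) {X Y Z A B C : ℂ × ℂ → ℂ} {s : Set (ℂ × ℂ)}
    (hX : DifferentiableOn ℂ X s) (hY : DifferentiableOn ℂ Y s) (hZ : DifferentiableOn ℂ Z s)
    (hA : DifferentiableOn ℂ A s) (hB : DifferentiableOn ℂ B s) (hC : DifferentiableOn ℂ C s) :
    DifferentiableOn ℂ (fun p => (X p * (B p ^ j - (-C p) ^ j) + Y p * (A p ^ j - C p ^ j) +
      (-1) ^ j * Z p * (B p ^ j - A p ^ j)) / 2) s := by
  fun_prop

lemma differentiableOn_thetaForm (j : ℕ) (a : Fin 4 → ℤ) :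
    DifferentiableOn ℂ (fun p : ℂ × ℂ => thetaForm j a p.1 p.2) {p : ℂ × ℂ | 0 < p.1.im} :=
  differentiableOn_combination j (differentiableOn_prod00 a) (differentiableOn_prod01 a)
    (differentiableOn_prod10 a) (differentiableOn_const (differentiableOn_prod00 0))
    (differentiableOn_const (differentiableOn_prod01 0))
    (differentiableOn_const (differentiableOn_prod10 0))

lemma hasExpansion_thetaSeed {j : ℕ} (hj : 1 ≤ j) {a : Fin 4 → ℤ} {s : ℤ}
    (hs : ∑ i, a i = 2 * s) :
    HasExpansion 1 (fun τ z => thetaSeed j a (2 * τ) z - 1) := by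
  have const_eq {f : (Fin 4 → ℤ) → ℂ → ℂ → ℂ} {g : ℂ → ℂ → ℂ}
      (hf : ∀ a τ z, f a τ z = ∏ i, g τ (a i * z)) (τ z : ℂ) : f 0 τ z = f 0 τ 0 := by
    simp [hf]
  have hX := hasExpansion_prod00 a
  have hZ := hasExpansion_prod10 hs
  have hB := (hasExpansion_prod01 0).pow_sub_one j
  have hC := (hasExpansion_prod10 (a := 0) (s := 0) (by simp)).neg.pow hj
  convert ((hX.mul_sub_one hB).add (hX.mul_of_sub_one hC).neg).add
    ((hB.mul_of_sub_one hZ).neg_one_pow_mul j) using 1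
  ext τ z
  simp only [Pi.add_apply, Pi.mul_apply, Pi.sub_apply, Pi.neg_apply, Pi.pow_apply, Pi.one_apply,
    const_eq (f := prod01) (fun _ _ _ => rfl) _ z, const_eq (f := prod10) (fun _ _ _ => rfl) _ z,
    thetaSeed, const01, const10]
  ring

lemma exists_sum_four_squares (m : ℕ) :
    ∃ a : Fin 4 → ℤ, ∑ i, a i ^ 2 = 2 * m ∧ ∃ s : ℤ, ∑ i, a i = 2 * s := by
  obtain ⟨a, b, c, d, h⟩ := Nat.sum_four_squares (2 * m)
  refine ⟨![a, b, c, d], ?_, ?_⟩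
  · simp [Fin.sum_univ_four]
    exact_mod_cast h
  · have hev : Even (a ^ 2 + b ^ 2 + c ^ 2 + d ^ 2) := h ▸ even_two_mul m
    have hev' : Even (a + b + c + d) := by
      simpa [Nat.even_add, Nat.even_pow] using hev
    obtain ⟨s, hs⟩ := even_iff_two_dvd.mp hev'
    exact ⟨s, by simp [Fin.sum_univ_four]; exact_mod_cast hs⟩

/-- Corollary 3.3 of Gritsenko–Wang: for every even weight `2k ≥ 4` and every
index `m ∈ ℕ` there exists a weak Jacobi form `F_{2k,m}` of weight `2k` and index `m` with
integral Fourier coefficients whose `q⁰`-term equals `1`. -/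
theorem exists_integral_weak_jacobi_with_qzero_term_one (k : ℤ) (hk : 2 ≤ k) (m : ℕ) :
    ∃ (φ : ℂ → ℂ → ℂ) (f : ℕ → ℤ → ℤ),
      IsWeakJacobiForm (2 * k) m φ (fun n l => (f n l : ℂ)) ∧
      f 0 0 = 1 ∧ (∀ l : ℤ, l ≠ 0 → f 0 l = 0) := by
  obtain ⟨a, ha, s, hs⟩ := exists_sum_four_squares m
  obtain ⟨j, rfl⟩ : ∃ j : ℕ, k = j + 1 := ⟨(k - 1).toNat, by omega⟩
  have hj : 1 ≤ j := by omega
  obtain ⟨b, hb0, hb⟩ := exists_coeff_of_hasExpansion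
    (f := fun τ z => thetaSeed j a τ z - 1) (hasExpansion_thetaSeed hj hs)
  refine ⟨thetaForm j a, fun n l => b n l + if (n, l) = (0, 0) then 1 else 0,
    ⟨differentiableOn_thetaForm j a, fun a' b' c d hdet => ?_,
      fun x y τ z _ => thetaForm_add_lattice j ha hs τ z x y, fun τ z hτ => ?_⟩, ?_, ?_⟩
  · refine slashInvariant_of_generators (fun τ z _ => thetaForm_add_one j a τ z)
      (fun τ z hτ => ?_) hdet
    have hτ0 : τ ≠ 0 := by
      rintro rfl
      simp at hτ
    rw [thetaForm_inv j ha hτ0, ← zpow_natCast]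
    push_cast
    ring_nf
  · convert (hb τ z hτ).add (hasSum_ite_eq ((0, 0) : ℕ × ℤ) (1 : ℂ)) using 1
    · ext p
      rcases eq_or_ne p (0, 0) with rfl | hp
      · simp [e2_zero]
      · simp [hp]
    · rw [thetaForm_eq]
      ring
  · simp [hb0]
  · intro l hl
    simp [hb0, hl]

end JacobiPaper
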